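/- (q-Pfaff–Saalschütz summation formula) Let n be a nonnegative integer and let q, a, b, c be complex numbers with q ≠ 0, q not a root of unity, a ≠ 0, b ≠ 0, c ≠ 0, such that c ≠ q^{-j} and a b q^{1-n}/c ≠ q^{-j} for every integer j with 0 ≤ j < n. Then ∑_{k=0}^n [(a;q)_k (b;q)_k (q^{-n};q)_k / ((q;q)_k (c;q)_k (a b q^{1-n}/c;q)_k)] q^k = (c/a;q)_n (c/b;q)_n / ((c;q)_n (c/(ab);q)_n). -/

import Mathlib

/-- The finite q-shifted factorial `(a;q)_k = ∏_{j=0}^{k-1} (1 - a q^j)`. -/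
noncomputable def qPoch (a q : ℂ) (k : ℕ) : ℂ := ∏ j ∈ Finset.range k, (1 - a * q ^ j)

theorem qPoch_succ (a q : ℂ) (k : ℕ) : qPoch a q (k+1) = qPoch a q k * (1 - a * q ^ k) := by
  simp [qPoch, Finset.prod_range_succ]

theorem qPoch_zero (a q : ℂ) : qPoch a q 0 = 1 := by simp [qPoch]

theorem qPoch_ne (a q : ℂ) (k : ℕ) (h : ∀ j, j < k → a * q ^ j ≠ 1) : qPoch a q k ≠ 0 := by
  unfold qPoch
  rw [Finset.prod_ne_zero_iff]
  intro j hj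
  exact sub_ne_zero.mpr (h j (Finset.mem_range.mp hj)).symm

/-- Telescoping of partial sums. -/
theorem tele (n : ℕ) (q a b d : ℂ) (hq0 : q ≠ 0) (u v : ℕ → ℂ)
    (hu : ∀ k, k ≤ n → u (k+1) * ((1 - q^(k+1)) * (1 - d*a*b*q^k))
      = u k * d * ((1 - a*q^k) * (1 - b*q^k)))
    (hv : ∀ m, v (m+1) * (1 - q^(m+1)) = v m * (1 - d * q^m)) (m : ℕ) (hm : m ≤ n + 1) :
    ∑ k ∈ Finset.range m, ((1 - d*a*b*q^n) * (1 - q^(n+1)) * (u k * v (n+1-k))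
      - (1 - d*b*q^n) * (1 - d*a*q^n) * (u k * v (n-k)))
    = - q^(n+1-m) * u m * (1 - q^m) * (1 - d*a*b*q^m/q) * v (n+1-m) := by
  induction m with
  | zero => simp
  | succ k ih =>
    rw [Finset.sum_range_succ, ih (by omega)]
    obtain ⟨m, rfl⟩ : ∃ m, n = k + m := ⟨n - k, by omega⟩
    have h1 : k + m + 1 - k = m + 1 := by omega
    have h2 : k + m - k = m := by omega
    have h3 : k + m + 1 - (k + 1) = m := by omega
    rw [h1, h2, h3]
    have e1 := hu k (by omega)
    have e2 := hv m
    have e3 : d*a*b*q^(k+1)/q = d*a*b*q^k := by rw [pow_succ]; field_simp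
    have e4 : q * (1 - d*a*b*q^k/q) = q - d*a*b*q^k := by field_simp
    rw [e3]
    simp only [pow_succ, pow_add] at *
    linear_combination u k * (1 - d*a*b*q^k*q^k*q^m) * e2 + q^m * v m * e1
      - q^m * u k * (1 - q^k) * v (m+1) * e4

/-- The division-light form of the sum. -/
theorem core (n : ℕ) (q a b d : ℂ) (hq0 : q ≠ 0)
    (hq1 : ∀ m : ℕ, 0 < m → q ^ m ≠ 1)
    (hc : ∀ j : ℕ, j < n → d*a*b * q ^ j ≠ 1) :
    ∑ k ∈ Finset.range (n + 1),
      (qPoch a q k * qPoch b q k * d^k / (qPoch q q k * qPoch (d*a*b) q k)) *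
        (qPoch d q (n-k) / qPoch q q (n-k))
    = qPoch (d*b) q n * qPoch (d*a) q n / (qPoch (d*a*b) q n * qPoch q q n) := by
  have hQ1 : ∀ k, 1 - q * q^k ≠ 0 := fun k => by
    have := hq1 (k+1) (by omega)
    rw [pow_succ'] at this
    exact sub_ne_zero.mpr this.symm
  have hQ : ∀ k, qPoch q q k ≠ 0 := fun k => qPoch_ne _ _ _ fun j _ => by
    have := hq1 (j+1) (by omega)
    rwa [pow_succ'] at this
  induction n with
  | zero => simp [qPoch_zero]
  | succ n ih =>
    have ih := ih fun j hj => hc j (by omega)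
    have hC1 : ∀ k, k ≤ n → 1 - d*a*b * q^k ≠ 0 := fun k hk =>
      sub_ne_zero.mpr (hc k (by omega)).symm
    have hC : ∀ k, k ≤ n + 1 → qPoch (d*a*b) q k ≠ 0 := fun k hk =>
      qPoch_ne _ _ _ fun j hj => hc j (by omega)
    set u : ℕ → ℂ := fun k =>
      qPoch a q k * qPoch b q k * d^k / (qPoch q q k * qPoch (d*a*b) q k) with hudef
    set v : ℕ → ℂ := fun m => qPoch d q m / qPoch q q m with hvdef
    have hu : ∀ k, k ≤ n → u (k+1) * ((1 - q^(k+1)) * (1 - d*a*b*q^k))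
      = u k * d * ((1 - a*q^k) * (1 - b*q^k)) := by
      intro k hk
      have h1 := hQ1 k
      have h2 := hC1 k hk
      have h3 := hQ k
      have h4 := hC k (by omega)
      simp only [hudef, qPoch_succ, pow_succ' q k, pow_succ d k]
      rw [div_mul_eq_mul_div, div_mul_eq_mul_div, div_mul_eq_mul_div, div_eq_div_iff (by positivity) (by positivity)]
      ring
    have hv : ∀ m, v (m+1) * (1 - q^(m+1)) = v m * (1 - d * q^m) := by
      intro m
      have h1 := hQ1 m
      have h3 := hQ m
      simp only [hvdef, qPoch_succ, pow_succ' q m]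
      rw [div_mul_eq_mul_div, div_mul_eq_mul_div, div_eq_div_iff (by positivity) (by positivity)]
      ring
    have ht := tele n q a b d hq0 u v hu hv (n+1) le_rfl
    have e3 : d*a*b*q^(n+1)/q = d*a*b*q^n := by rw [pow_succ]; field_simp
    rw [e3, Finset.sum_sub_distrib, ← Finset.mul_sum, ← Finset.mul_sum] at ht
    change ∑ k ∈ Finset.range (n+1), u k * v (n - k) = _ at ih
    change ∑ k ∈ Finset.range (n+1+1), u k * v (n + 1 - k) = _
    rw [ih] at ht
    rw [Finset.sum_range_succ]
    have h1 := hQ1 n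
    have h2 := hC1 n le_rfl
    have h3 := hQ n
    have h4 := hC n (by omega)
    simp only [qPoch_succ]
    rw [eq_div_iff (by positivity)]
    rw [← mul_div_assoc, ] at ht
    simp only [Nat.sub_self, pow_zero] at ht ⊢
    rw [pow_succ'] at ht
    set X := qPoch (d*a*b) q n
    set Y := qPoch q q n
    set P := qPoch (d*b) q n
    set R := qPoch (d*a) q n
    have hd : (1 - d*b*q^n) * (1 - d*a*q^n) * (P * R) / (X * Y) * (X * Y)
       = (1 - d*b*q^n) * (1 - d*a*q^n) * (P * R) := div_mul_cancel₀ _ (by positivity)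
    linear_combination (X * Y) * ht + hd

theorem term_conv (n : ℕ) (q d e : ℂ) (hq0 : q ≠ 0) (hd0 : d ≠ 0)
    (hq1 : ∀ m : ℕ, 0 < m → q ^ m ≠ 1)
    (hd : ∀ j : ℕ, j < n → d * q ^ j ≠ 1) 
    (he : e * d * q ^ n = q) (k : ℕ) (hk : k ≤ n) :
    qPoch (q ^ (-(n : ℤ))) q k * q^k * (qPoch q q (n-k) * qPoch d q n)
     = d^k * qPoch q q n * qPoch d q (n-k) * qPoch e q k := by
  induction k with
  | zero => simp [qPoch_zero]
  | succ k ih =>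
    have ih := ih (by omega)
    obtain ⟨m, rfl⟩ : ∃ m, n = k + 1 + m := ⟨n - (k+1), by omega⟩
    have h1 : k + 1 + m - k = m + 1 := by omega
    have h2 : k + 1 + m - (k + 1) = m := by omega
    rw [h1] at ih
    rw [h2]
    simp only [qPoch_succ] at ih ⊢
    have hQ1 : 1 - q * q^m ≠ 0 := by
      have := hq1 (m+1) (by omega)
      rw [pow_succ'] at this
      exact sub_ne_zero.mpr this.symm
    have hz : q ^ (-((k + 1 + m : ℕ) : ℤ)) * q ^ (k+1+m) = 1 := by
      rw [zpow_neg, zpow_natCast]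
      exact inv_mul_cancel₀ (pow_ne_zero _ hq0)
    generalize q ^ (-((k + 1 + m : ℕ) : ℤ)) = z at *
    have hqm : q^m ≠ 0 := pow_ne_zero _ hq0
    have hE : e * q^k * (d * q^m) = 1 := by
      apply mul_right_cancel₀ hq0
      rw [pow_add, pow_succ] at he
      linear_combination he
    have hZ : z * q^k * (q * q^m) = 1 := by
      rw [pow_add, pow_succ] at hz
      linear_combination hz
    apply mul_right_cancel₀ hQ1
    apply mul_right_cancel₀ hqm
    rw [pow_succ q k, pow_succ d k]
    have f1 : (1 - z * q^k) * q * q^m = -(1 - q * q^m) := by linear_combination -hZ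
    have f2 : (1 - e * q^k) * (d * q^m) = -(1 - d*q^m) := by linear_combination -hE
    generalize qPoch q q (k+1+m) = Qn at *
    generalize qPoch d q (k+1+m) = Dn at *
    linear_combination (-(1 - q*q^m)) * ih
      + (qPoch z q k * q^k * (qPoch q q m * Dn) * (1 - q*q^m)) * f1
      - (d^k * Qn * qPoch d q m * qPoch e q k * (1 - q*q^m)) * f2

/-- The q-Pfaff–Saalschütz summation formula. -/
theorem q_pfaff_saalschuetz (n : ℕ) (q a b c : ℂ) (hq0 : q ≠ 0)
    (hq1 : ∀ m : ℕ, 0 < m → q ^ m ≠ 1) (ha : a ≠ 0) (hb : b ≠ 0) (hc0 : c ≠ 0)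
    (hc : ∀ j : ℕ, j < n → c ≠ q ^ (-(j : ℤ)))
    (habc : ∀ j : ℕ, j < n → a * b * q ^ (1 - (n : ℤ)) / c ≠ q ^ (-(j : ℤ))) :
    ∑ k ∈ Finset.range (n + 1),
      qPoch a q k * qPoch b q k * qPoch (q ^ (-(n : ℤ))) q k /
        (qPoch q q k * qPoch c q k * qPoch (a * b * q ^ (1 - (n : ℤ)) / c) q k) * q ^ k
    = qPoch (c / a) q n * qPoch (c / b) q n /
        (qPoch c q n * qPoch (c / (a * b)) q n) := by
  obtain ⟨d, rfl⟩ : ∃ d, c = d * a * b := ⟨c / (a*b), by field_simp⟩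
  have hd0 : d ≠ 0 := by rintro rfl; simp at hc0
  have hinv : ∀ (x : ℂ) (j : ℕ), x ≠ q ^ (-(j : ℤ)) → x * q^j ≠ 1 := by
    intro x j h h'
    apply h
    rw [zpow_neg, zpow_natCast]
    exact eq_inv_of_mul_eq_one_left h'
  have r1 : d * a * b / a = d * b := by field_simp
  have r2 : d * a * b / b = d * a := by field_simp
  have r3 : d * a * b / (a * b) = d := by field_simp
  rw [r1, r2, r3]
  have hc' : ∀ j : ℕ, j < n → d*a*b * q ^ j ≠ 1 := fun j hj => hinv _ _ (hc j hj)
  have he : a * b * q ^ (1 - (n : ℤ)) / (d * a * b) * d * q ^ n = q := by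
    rw [zpow_sub₀ hq0, zpow_one, zpow_natCast]
    field_simp
  have he' : ∀ j : ℕ, j < n → (a * b * q ^ (1 - (n : ℤ)) / (d * a * b)) * q ^ j ≠ 1 :=
    fun j hj => hinv _ _ (habc j hj)
  generalize a * b * q ^ (1 - (n : ℤ)) / (d * a * b) = e at *
  have hd : ∀ j : ℕ, j < n → d * q ^ j ≠ 1 := by
    intro j hj h
    apply he' (n - 1 - j) (by omega)
    obtain ⟨i, rfl⟩ : ∃ i, n = j + i + 1 := ⟨n - 1 - j, by omega⟩
    have : j + i + 1 - 1 - j = i := by omega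
    rw [this]
    apply mul_right_cancel₀ hq0
    rw [pow_succ, pow_add] at he
    linear_combination he - e * q^i * q * h
  have hQ : ∀ k, qPoch q q k ≠ 0 := fun k => qPoch_ne _ _ _ fun j _ => by
    have := hq1 (j+1) (by omega)
    rwa [pow_succ'] at this
  have hD := qPoch_ne d q n hd
  have hQn := hQ n
  have hCn := qPoch_ne _ q n hc'
  have key := core n q a b d hq0 hq1 hc'
  have : qPoch (d*b) q n * qPoch (d*a) q n / (qPoch (d*a*b) q n * qPoch d q n)
     = qPoch (d*b) q n * qPoch (d*a) q n / (qPoch (d*a*b) q n * qPoch q q n)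
       * (qPoch q q n / qPoch d q n) := by
    field_simp
  rw [this, ← key, Finset.sum_mul]
  apply Finset.sum_congr rfl
  intro k hk
  have hk : k ≤ n := by simpa [Nat.lt_succ_iff] using hk
  have hE := qPoch_ne e q k fun j hj => he' j (by omega)
  have hC := qPoch_ne _ q k fun j hj => hc' j (by omega)
  have h1 := hQ k
  have h2 := hQ (n-k)
  have cv := term_conv n q d e hq0 hd0 hq1 hd he k hk
  have cv2 : qPoch (q ^ (-(n : ℤ))) q k * q^k / qPoch e q k
     = d^k * qPoch q q n * qPoch d q (n-k) / (qPoch q q (n-k) * qPoch d q n) := by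
    rw [div_eq_div_iff hE (mul_ne_zero h2 hD)]
    exact cv
  calc _ = qPoch a q k * qPoch b q k / (qPoch q q k * qPoch (d*a*b) q k) *
        (qPoch (q ^ (-(n : ℤ))) q k * q^k / qPoch e q k) := by
        simp only [div_eq_mul_inv, mul_inv]; ring
    _ = _ := by
        rw [cv2]; simp only [div_eq_mul_inv, mul_inv]; ring
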